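/- Let n be odd. Then n!·(n−1)!·AT(n) = (−1)^{n(n−1)/2} Σ_{A∈B_n} (−1)^{σ0(A)} per(A)·det(A)^{n−1}, where the sum is over all n×n (0,1)-matrices A (permanents and determinants computed over ℤ). -/

import Mathlib

/-- `L` is a Latin square of order `n`: every row and every column is a
bijection of `Fin n` (i.e. contains each symbol exactly once). -/
def IsLatin {n : ℕ} (L : Fin n → Fin n → Fin n) : Prop :=
  (∀ i, Function.Bijective fun j => L i j) ∧ ∀ j, Function.Bijective fun i => L i j

/-- The permutation determined by a bijective function (junk value `1` otherwise). -/
noncomputable def permOf {n : ℕ} (f : Fin n → Fin n) : Equiv.Perm (Fin n) :=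
  if h : Function.Bijective f then Equiv.ofBijective f h else 1

/-- The product of the signs of the rows of `L`. -/
noncomputable def rowSign {n : ℕ} (L : Fin n → Fin n → Fin n) : ℤ :=
  ∏ i, (Equiv.Perm.sign (permOf fun j => L i j) : ℤ)

/-- The product of the signs of the columns of `L`. -/
noncomputable def colSign {n : ℕ} (L : Fin n → Fin n → Fin n) : ℤ :=
  ∏ j, (Equiv.Perm.sign (permOf fun i => L i j) : ℤ)

/-- The sign of a Latin square: row-sign times column-sign. -/
noncomputable def latinSign {n : ℕ} (L : Fin n → Fin n → Fin n) : ℤ :=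
  rowSign L * colSign L

/-- The permutation `α_s` of a Latin square `L`: `α_s i = j` iff `L i j = s`. -/
noncomputable def symPerm {n : ℕ} (L : Fin n → Fin n → Fin n) (s : Fin n) :
    Equiv.Perm (Fin n) :=
  permOf fun i => (permOf fun j => L i j).symm s

/-- The symbol-sign of a Latin square: the product of the signs of the `α_s`. -/
noncomputable def symbolSign {n : ℕ} (L : Fin n → Fin n → Fin n) : ℤ :=
  ∏ s, (Equiv.Perm.sign (symPerm L s) : ℤ)

/-- The number of Latin squares of order `n`. -/
noncomputable def numLatin (n : ℕ) : ℕ :=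
  Nat.card {L : Fin n → Fin n → Fin n // IsLatin L}

/-- The number of even Latin squares of order `n`. -/
noncomputable def numLatinEven (n : ℕ) : ℕ :=
  Nat.card {L : Fin n → Fin n → Fin n // IsLatin L ∧ latinSign L = 1}

/-- The number of odd Latin squares of order `n`. -/
noncomputable def numLatinOdd (n : ℕ) : ℕ :=
  Nat.card {L : Fin n → Fin n → Fin n // IsLatin L ∧ latinSign L = -1}

/-- `L` is normalized: its first row is the identity permutation. -/
def IsNormalized {n : ℕ} (L : Fin n → Fin n → Fin n) : Prop :=
  ∀ j : Fin n, L ⟨0, j.pos⟩ j = j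

/-- `L` is unipotent: all entries on the main diagonal are equal. -/
def IsUnipotent {n : ℕ} (L : Fin n → Fin n → Fin n) : Prop :=
  ∀ i k : Fin n, L i i = L k k

/-- The Alon-Tarsi constant `AT(n) = U_n^E - U_n^O`. -/
noncomputable def AT (n : ℕ) : ℤ :=
  (Nat.card {L : Fin n → Fin n → Fin n //
      IsLatin L ∧ IsNormalized L ∧ IsUnipotent L ∧ latinSign L = 1} : ℤ) -
  (Nat.card {L : Fin n → Fin n → Fin n //
      IsLatin L ∧ IsNormalized L ∧ IsUnipotent L ∧ latinSign L = -1} : ℤ)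

/-- `L` is reduced: first row and first column are the identity. -/
def IsReducedLatin {n : ℕ} (L : Fin n → Fin n → Fin n) : Prop :=
  IsNormalized L ∧ ∀ i : Fin n, L i ⟨0, i.pos⟩ = i

/-- The number of even reduced Latin squares of order `n`. -/
noncomputable def numReducedEven (n : ℕ) : ℕ :=
  Nat.card {L : Fin n → Fin n → Fin n // IsLatin L ∧ IsReducedLatin L ∧ latinSign L = 1}

/-- The number of odd reduced Latin squares of order `n`. -/
noncomputable def numReducedOdd (n : ℕ) : ℕ :=
  Nat.card {L : Fin n → Fin n → Fin n // IsLatin L ∧ IsReducedLatin L ∧ latinSign L = -1}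

/-- `L_n^SE(π)`: Latin squares whose permutation `α₁` (of the first symbol)
is `π` and whose symbol-sign is `+1`. The first symbol is the element of
`Fin n` with value `0`, and `α₁ = π` is expressed by `L i (π i) = first symbol`. -/
noncomputable def numSymEven (n : ℕ) (π : Equiv.Perm (Fin n)) : ℕ :=
  Nat.card {L : Fin n → Fin n → Fin n //
    IsLatin L ∧ (∀ i, (L i (π i)).val = 0) ∧ symbolSign L = 1}

/-- `L_n^SO(π)`: as `numSymEven` but with symbol-sign `-1`. -/
noncomputable def numSymOdd (n : ℕ) (π : Equiv.Perm (Fin n)) : ℕ :=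
  Nat.card {L : Fin n → Fin n → Fin n //
    IsLatin L ∧ (∀ i, (L i (π i)).val = 0) ∧ symbolSign L = -1}

/-- `L_n^CE(π)`: column-even Latin squares with first column `π`. -/
noncomputable def numColEven (n : ℕ) (π : Equiv.Perm (Fin n)) : ℕ :=
  Nat.card {L : Fin n → Fin n → Fin n //
    IsLatin L ∧ (∀ i : Fin n, L i ⟨0, i.pos⟩ = π i) ∧ colSign L = 1}

/-- `L_n^CO(π)`: column-odd Latin squares with first column `π`. -/
noncomputable def numColOdd (n : ℕ) (π : Equiv.Perm (Fin n)) : ℕ :=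
  Nat.card {L : Fin n → Fin n → Fin n //
    IsLatin L ∧ (∀ i : Fin n, L i ⟨0, i.pos⟩ = π i) ∧ colSign L = -1}

/-- `L_n^CE(α, β)`: column-even Latin squares with first row `α` and first column `β`. -/
noncomputable def numColEven₂ (n : ℕ) (α β : Equiv.Perm (Fin n)) : ℕ :=
  Nat.card {L : Fin n → Fin n → Fin n //
    IsLatin L ∧ (∀ j : Fin n, L ⟨0, j.pos⟩ j = α j) ∧
      (∀ i : Fin n, L i ⟨0, i.pos⟩ = β i) ∧ colSign L = 1}

/-- `L_n^CO(α, β)`: column-odd Latin squares with first row `α` and first column `β`. -/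
noncomputable def numColOdd₂ (n : ℕ) (α β : Equiv.Perm (Fin n)) : ℕ :=
  Nat.card {L : Fin n → Fin n → Fin n //
    IsLatin L ∧ (∀ j : Fin n, L ⟨0, j.pos⟩ j = α j) ∧
      (∀ i : Fin n, L i ⟨0, i.pos⟩ = β i) ∧ colSign L = -1}

/-- The `n × n` matrix of indeterminates, over `ℤ`. -/
noncomputable def Xmat (n : ℕ) :
    Matrix (Fin n) (Fin n) (MvPolynomial (Fin n × Fin n) ℤ) :=
  Matrix.of fun i j => MvPolynomial.X (i, j)

/-- The exponent vector of the square-free monomial `∏_{i,j} X i j`. -/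
noncomputable def allOnes (n : ℕ) : (Fin n × Fin n) →₀ ℕ :=
  Finsupp.equivFunOnFinite.symm fun _ => 1

/-- The `(0,1)`-matrix (over `ℤ`) associated to a Boolean matrix. -/
def toInt {n : ℕ} (A : Fin n → Fin n → Bool) : Matrix (Fin n) (Fin n) ℤ :=
  Matrix.of fun i j => if A i j then 1 else 0

/-- `σ₀(A)`: the number of zero entries of a `(0,1)`-matrix. -/
def sigma0 {n : ℕ} (A : Fin n → Fin n → Bool) : ℕ :=
  (Finset.univ.filter fun p : Fin n × Fin n => A p.1 p.2 = false).card

/-- The sum of a product of entrywise functions over all matrices factors. -/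
theorem sum_matrix_prod_eq_prod_sum {ι κ β R : Type*} [Fintype ι] [DecidableEq ι] [Fintype κ]
    [DecidableEq κ] [Fintype β] [CommSemiring R] (f : ι → κ → β → R) :
    ∑ A : ι → κ → β, ∏ i, ∏ j, f i j (A i j) = ∏ i, ∏ j, ∑ b, f i j b := by
  simp_rw [Fintype.prod_sum]

theorem permOf_apply {n : ℕ} {f : Fin n → Fin n} (h : Function.Bijective f) (i : Fin n) :
    permOf f i = f i := by
  rw [permOf, dif_pos h, Equiv.ofBijective_apply]

theorem symPerm_apply_eq_iff {n : ℕ} {L : Fin n → Fin n → Fin n} (hL : IsLatin L)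
    (s i j : Fin n) : symPerm L s i = j ↔ L i j = s := by
  have hrow (i j) : (permOf fun j => L i j) j = L i j := permOf_apply (hL.1 i) j
  have hbij : Function.Bijective fun i => (permOf fun j => L i j).symm s := by
    rw [← Finite.injective_iff_bijective]
    intro i i' h
    apply (hL.2 ((permOf fun j => L i j).symm s)).1
    change L i _ = L i' _
    conv_rhs => rw [show (permOf fun j => L i j).symm s = (permOf fun j => L i' j).symm s from h]
    rw [← hrow, ← hrow, Equiv.apply_symm_apply, Equiv.apply_symm_apply]
  rw [symPerm, permOf_apply hbij, Equiv.symm_apply_eq, hrow]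
  exact eq_comm

theorem sign_prodComm_fin (n : ℕ) :
    Equiv.Perm.sign (Equiv.prodComm (Fin n) (Fin n) : Equiv.Perm (Fin n × Fin n))
      = (-1) ^ (n * (n - 1) / 2) := by
  have hfix : Fintype.card (Function.fixedPoints
      (Equiv.prodComm (Fin n) (Fin n) : Equiv.Perm (Fin n × Fin n))) = n := by
    refine (Fintype.card_congr (β := Fin n)
      ⟨fun p => p.1.1, fun i => ⟨(i, i), by simp [Function.mem_fixedPoints, Function.IsFixedPt]⟩,
        ?_, fun _ => rfl⟩).trans (Fintype.card_fin n)
    rintro ⟨⟨i, j⟩, h⟩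
    simp only [Function.mem_fixedPoints, Function.IsFixedPt, Equiv.prodComm_apply, Prod.swap_prod_mk,
      Prod.mk.injEq] at h
    simp [h.1]
  rw [Equiv.Perm.sign_of_pow_two_eq_one (by ext p <;> simp [sq]), hfix, Fintype.card_prod,
    Fintype.card_fin, Nat.mul_sub_one]

/-- The row-sign, the column-sign and the symbol-sign of a Latin square of order `n` multiply
to `(-1)^{n(n-1)/2}`. -/
theorem latinSign_mul_symbolSign {n : ℕ} {L : Fin n → Fin n → Fin n} (hL : IsLatin L) :
    latinSign L * symbolSign L = (-1) ^ (n * (n - 1) / 2) := by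
  have hcomp : (Equiv.prodCongrLeft fun j => permOf fun i => L i j : Equiv.Perm (Fin n × Fin n))
      = (Equiv.prodCongrRight (symPerm L) : Equiv.Perm (Fin n × Fin n))
        * (Equiv.prodComm (Fin n) (Fin n) : Equiv.Perm (Fin n × Fin n))
        * (Equiv.prodCongrRight fun i => permOf fun j => L i j : Equiv.Perm (Fin n × Fin n)) := by
    refine Equiv.ext fun ⟨i, j⟩ => ?_
    have h : symPerm L (L i j) i = j := (symPerm_apply_eq_iff hL _ _ _).2 rfl
    simp [permOf_apply (hL.1 i), permOf_apply (hL.2 j), h]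
  have hsign := congrArg (fun σ => ((Equiv.Perm.sign σ : ℤˣ) : ℤ)) hcomp
  simp only [Equiv.Perm.sign_mul, Equiv.Perm.sign_prodCongrLeft, Equiv.Perm.sign_prodCongrRight,
    sign_prodComm_fin, Units.val_mul, Units.coe_prod, Units.val_pow_eq_pow_val, Units.val_neg,
    Units.val_one] at hsign
  change colSign L = symbolSign L * _ * rowSign L at hsign
  have hrow : rowSign L * rowSign L = 1 := by
    simp only [rowSign, ← Finset.prod_mul_distrib]
    exact Finset.prod_eq_one fun i _ => by rw [← Units.val_mul, Int.units_mul_self, Units.val_one]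
  have hsym : symbolSign L * symbolSign L = 1 := by
    simp only [symbolSign, ← Finset.prod_mul_distrib]
    exact Finset.prod_eq_one fun i _ => by rw [← Units.val_mul, Int.units_mul_self, Units.val_one]
  rw [latinSign, hsign]
  linear_combination (-1) ^ (n * (n - 1) / 2) * (symbolSign L * symbolSign L) * hrow
    + (-1) ^ (n * (n - 1) / 2) * hsym

theorem latinSign_eq_one_or_neg_one {n : ℕ} (L : Fin n → Fin n → Fin n) :
    latinSign L = 1 ∨ latinSign L = -1 := by
  simp only [latinSign, rowSign, colSign, ← Units.coe_prod, ← Units.val_mul]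
  exact (Int.units_eq_one_or _).imp (congrArg Units.val) (congrArg Units.val)

theorem permOf_comp {n : ℕ} {f : Fin n → Fin n} (hf : Function.Bijective f)
    (σ τ : Equiv.Perm (Fin n)) : permOf (fun j => σ (f (τ j))) = σ * permOf f * τ := by
  ext j
  have hcomp : Function.Bijective fun j => σ (f (τ j)) :=
    σ.bijective.comp (hf.comp τ.bijective)
  simp [permOf_apply hf, permOf_apply hcomp]

theorem IsLatin.comp {n : ℕ} {L : Fin n → Fin n → Fin n} (hL : IsLatin L)
    (σ τ : Equiv.Perm (Fin n)) : IsLatin fun i j => σ (L i (τ j)) :=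
  ⟨fun i => σ.bijective.comp ((hL.1 i).comp τ.bijective),
    fun j => σ.bijective.comp (hL.2 (τ j))⟩

/-- For odd `n`, permuting symbols preserves the sign of a Latin square, and permuting columns
by `τ` multiplies it by the sign of `τ`. -/
theorem latinSign_comp {n : ℕ} (hn : Odd n) {L : Fin n → Fin n → Fin n} (hL : IsLatin L)
    (σ τ : Equiv.Perm (Fin n)) :
    latinSign (fun i j => σ (L i (τ j))) = latinSign L * (Equiv.Perm.sign τ : ℤ) := by
  have hpow (ρ : Equiv.Perm (Fin n)) : Equiv.Perm.sign ρ ^ n = Equiv.Perm.sign ρ := by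
    obtain h | h := Int.units_eq_one_or (Equiv.Perm.sign ρ) <;> simp [h, hn.neg_one_pow]
  have hcol (j : Fin n) : permOf (fun i => σ (L i (τ j))) = σ * permOf fun i => L i (τ j) := by
    simpa using permOf_comp (hL.2 (τ j)) σ 1
  have hreindex : ∏ j, Equiv.Perm.sign (permOf fun i => L i (τ j))
      = ∏ j, Equiv.Perm.sign (permOf fun i => L i j) :=
    Equiv.prod_comp τ fun j => Equiv.Perm.sign (permOf fun i => L i j)
  simp only [latinSign, rowSign, colSign, ← Units.coe_prod, ← Units.val_mul, permOf_comp (hL.1 _),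
    hcol, Equiv.Perm.sign_mul, Finset.prod_mul_distrib, Finset.prod_const, Finset.card_univ,
    Fintype.card_fin, hpow, hreindex]
  congr 1
  obtain h | h := Int.units_eq_one_or (Equiv.Perm.sign σ) <;> simp [h, mul_right_comm]

theorem symPerm_comp {n : ℕ} {L : Fin n → Fin n → Fin n} (hL : IsLatin L) (s : Fin n)
    (hdiag : ∀ i, L i i = s) {σ : Equiv.Perm (Fin n)} (hσ : σ s = s) (τ : Equiv.Perm (Fin n)) :
    symPerm (fun i j => σ (L i (τ j))) s = τ⁻¹ := by
  ext i : 1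
  rw [symPerm_apply_eq_iff (hL.comp σ τ)]
  simp [hdiag, hσ]

theorem IsNormalized.apply_self {m : ℕ} {U : Fin (m + 1) → Fin (m + 1) → Fin (m + 1)}
    (hN : IsNormalized U) (hU : IsUnipotent U) (i : Fin (m + 1)) : U i i = 0 :=
  (hU i 0).trans (hN 0)

/-- Every Latin square is obtained in a unique way from a normalized unipotent one by permuting
columns and permuting the symbols other than the first. -/
theorem bijective_permute_normalized_unipotent (m : ℕ) :
    Function.Bijective (fun x : Equiv.Perm (Fin (m + 1)) ×
        {σ : Equiv.Perm (Fin (m + 1)) // σ 0 = 0} ×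
        {U : Fin (m + 1) → Fin (m + 1) → Fin (m + 1) //
          IsLatin U ∧ IsNormalized U ∧ IsUnipotent U} =>
      (⟨fun i j => x.2.1.1 (x.2.2.1 i (x.1 j)), x.2.2.2.1.comp _ _⟩ :
        {L : Fin (m + 1) → Fin (m + 1) → Fin (m + 1) // IsLatin L})) := by
  constructor
  · rintro ⟨τ, ⟨σ, hσ⟩, U, hU, hUn, hUu⟩ ⟨τ', ⟨σ', hσ'⟩, U', hU', hUn', hUu'⟩ h
    replace h (i j) : σ (U i (τ j)) = σ' (U' i (τ' j)) :=
      congrFun (congrFun (congrArg Subtype.val h) i) j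
    have hτ : τ = τ' := by
      rw [← inv_inj, ← symPerm_comp hU 0 (hUn.apply_self hUu) hσ,
        ← symPerm_comp hU' 0 (hUn'.apply_self hUu') hσ']
      simp only [h]
    subst hτ
    have hσσ : σ = σ' := by
      ext j : 1
      have h0 := h 0 (τ.symm j)
      rw [Equiv.apply_symm_apply] at h0
      rwa [show U 0 j = j from hUn j, show U' 0 j = j from hUn' j] at h0
    subst hσσ
    have hUU : U = U' := by
      funext i j
      simpa using h i (τ.symm j)
    subst hUU
    rfl
  · rintro ⟨L, hL⟩
    let τ := symPerm L 0
    have hτ (i) : L i (τ i) = 0 := (symPerm_apply_eq_iff hL _ _ _).1 rfl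
    let σ := permOf fun j => L 0 (τ j)
    have hσ (j) : σ j = L 0 (τ j) := permOf_apply ((hL.1 0).comp τ.bijective) j
    have hσ0 : σ 0 = 0 := (hσ 0).trans (hτ 0)
    refine ⟨⟨τ⁻¹, ⟨σ, hσ0⟩, fun i j => σ⁻¹ (L i (τ j)), hL.comp _ _, fun j => ?_,
      fun i k => ?_⟩, ?_⟩
    · exact Equiv.Perm.inv_eq_iff_eq.2 (hσ j).symm
    · simp only [hτ]
    · ext i j : 3
      simp

theorem card_perm_fixing_zero (m : ℕ) :
    Fintype.card {σ : Equiv.Perm (Fin (m + 1)) // σ 0 = 0} = m.factorial := by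
  rw [← Fintype.card_perm.trans (congrArg _ (Fintype.card_fin m))]
  symm
  refine Fintype.card_of_bijective
    (f := fun e => ⟨Equiv.Perm.decomposeFin.symm (0, e), by simp⟩) ⟨fun e e' h => ?_, ?_⟩
  · simpa using congrArg Subtype.val h
  · rintro ⟨σ, hσ⟩
    obtain ⟨⟨p, e⟩, rfl⟩ := Equiv.Perm.decomposeFin.symm.surjective σ
    obtain rfl : p = 0 := by simpa using hσ
    exact ⟨e, rfl⟩

open Classical in
theorem AT_eq_sum_latinSign (n : ℕ) :
    AT n = ∑ U : {U : Fin n → Fin n → Fin n // IsLatin U ∧ IsNormalized U ∧ IsUnipotent U},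
      latinSign U.1 := by
  have hterm (L : Fin n → Fin n → Fin n) :
      latinSign L = (if latinSign L = 1 then 1 else 0) - if latinSign L = -1 then 1 else 0 := by
    obtain h | h := latinSign_eq_one_or_neg_one L <;> simp [h]
  rw [← Finset.sum_subtype (Finset.univ.filter fun U => IsLatin U ∧ IsNormalized U ∧ IsUnipotent U)
    (by simp) latinSign, Finset.sum_congr rfl fun L _ => hterm L, Finset.sum_sub_distrib,
    Finset.sum_boole, Finset.sum_boole, Finset.filter_filter, Finset.filter_filter, AT,
    Nat.card_eq_fintype_card, Nat.card_eq_fintype_card, Fintype.card_subtype, Fintype.card_subtype]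
  simp only [and_assoc]

open Classical in
theorem sum_latinSign_mul_sign_symPerm {m : ℕ} (hm : Odd (m + 1)) :
    ∑ L : {L : Fin (m + 1) → Fin (m + 1) → Fin (m + 1) // IsLatin L},
        latinSign L.1 * (Equiv.Perm.sign (symPerm L.1 0) : ℤ)
      = ((m + 1).factorial : ℤ) * m.factorial * AT (m + 1) := by
  rw [← (bijective_permute_normalized_unipotent m).sum_comp]
  have hterm (x : Equiv.Perm (Fin (m + 1)) × {σ : Equiv.Perm (Fin (m + 1)) // σ 0 = 0} ×
      {U : Fin (m + 1) → Fin (m + 1) → Fin (m + 1) //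
        IsLatin U ∧ IsNormalized U ∧ IsUnipotent U}) :
      latinSign (fun i j => x.2.1.1 (x.2.2.1 i (x.1 j))) *
        (Equiv.Perm.sign (symPerm (fun i j => x.2.1.1 (x.2.2.1 i (x.1 j))) 0) : ℤ)
      = latinSign x.2.2.1 := by
    obtain ⟨τ, ⟨σ, hσ⟩, U, hU, hUn, hUu⟩ := x
    rw [latinSign_comp hm hU, symPerm_comp hU 0 (hUn.apply_self hUu) hσ, Equiv.Perm.sign_inv,
      mul_assoc, ← Units.val_mul, Int.units_mul_self, Units.val_one, mul_one]
  simp only [hterm]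
  simp only [Fintype.sum_prod_type]
  rw [Finset.sum_const, Finset.sum_const, Finset.card_univ, Finset.card_univ, Fintype.card_perm,
    Fintype.card_fin, card_perm_fixing_zero, AT_eq_sum_latinSign, nsmul_eq_mul, nsmul_eq_mul, mul_assoc]

/-- Latin squares correspond, via their symbol permutations, to families of permutations whose
graphs cover all positions. -/
theorem bijective_symPerm (n : ℕ) :
    Function.Bijective (fun L : {L : Fin n → Fin n → Fin n // IsLatin L} =>
      (⟨symPerm L.1, fun i j => ⟨L.1 i j, (symPerm_apply_eq_iff L.2 _ _ _).2 rfl⟩⟩ :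
        {π : Fin n → Equiv.Perm (Fin n) // ∀ i j, ∃ k, π k i = j})) := by
  constructor
  · rintro ⟨L, hL⟩ ⟨L', hL'⟩ h
    replace h : symPerm L = symPerm L' := congrArg Subtype.val h
    ext i j : 3
    symm
    rw [← symPerm_apply_eq_iff hL', ← h, symPerm_apply_eq_iff hL]
  · rintro ⟨π, hπ⟩
    choose L h using id hπ
    have hinj (i : Fin n) : Function.Injective fun k => π k i :=
      Finite.injective_iff_surjective.2 fun j => ⟨L i j, h i j⟩
    have hL : IsLatin L := by
      refine ⟨fun i => Finite.injective_iff_bijective.1 fun j j' hj => ?_,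
        fun j => Finite.injective_iff_bijective.1 fun i i' hi => ?_⟩
      · rw [← h i j, ← h i j']
        exact congrArg (fun k => π k i) hj
      · apply (π (L i j)).injective
        rw [h, show L i j = L i' j from hi, h]
    refine ⟨⟨L, hL⟩, Subtype.ext (funext fun s => Equiv.ext fun i => ?_)⟩
    exact (symPerm_apply_eq_iff hL _ _ _).2 (hinj i (h i (π s i)))

open Classical in
/-- The alternating sum over all `(0,1)`-matrices extracts the square-free monomial in all the
entries from a product of `n` permutation monomials. -/
theorem sum_sigma0_mul_prod {n : ℕ} (π : Fin n → Equiv.Perm (Fin n)) :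
    ∑ A : Fin n → Fin n → Bool, (-1 : ℤ) ^ sigma0 A * ∏ k, ∏ i, toInt A i (π k i)
      = if ∀ i j, ∃ k, π k i = j then 1 else 0 := by
  have hterm (A : Fin n → Fin n → Bool) :
      (-1 : ℤ) ^ sigma0 A * ∏ k, ∏ i, toInt A i (π k i)
        = ∏ i, ∏ j, ((if A i j = false then -1 else 1) *
            ∏ k, if π k i = j then (if A i j then 1 else 0) else 1) := by
    simp only [Finset.prod_mul_distrib]
    congr 1
    · rw [← Fintype.prod_prod_type' fun i j => if A i j = false then (-1 : ℤ) else 1,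
        Finset.prod_ite, Finset.prod_const, Finset.prod_const_one, mul_one, sigma0]
    · rw [Finset.prod_comm]
      refine Finset.prod_congr rfl fun i _ => ?_
      rw [Finset.prod_comm]
      refine Finset.prod_congr rfl fun k _ => ?_
      rw [Finset.prod_ite_eq]
      simp [toInt]
  simp only [hterm]
  rw [sum_matrix_prod_eq_prod_sum fun i j b => ((if b = false then (-1 : ℤ) else 1) *
    ∏ k, if π k i = j then (if b then 1 else 0) else 1)]
  have hsum (i j : Fin n) : ∑ b : Bool, ((if b = false then (-1 : ℤ) else 1) *
      ∏ k, if π k i = j then (if b then 1 else 0) else 1) = if ∃ k, π k i = j then 1 else 0 := by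
    simp only [Fintype.sum_bool]
    by_cases h : ∃ k, π k i = j
    · obtain ⟨k, hk⟩ := h
      have hz : ∏ k, (if π k i = j then (0 : ℤ) else 1) = 0 :=
        Finset.prod_eq_zero (Finset.mem_univ k) (by simp [hk])
      simp [hz, show ∃ k, π k i = j from ⟨k, hk⟩]
    · push Not at h
      simp [h]
  simp only [hsum]
  split_ifs with h
  · simp [h]
  · push Not at h
    obtain ⟨i, j, hij⟩ := h
    exact Finset.prod_eq_zero (Finset.mem_univ i)
      (Finset.prod_eq_zero (Finset.mem_univ j) (by simp [hij]))

theorem permanent_mul_det_pow {m : ℕ} (M : Matrix (Fin (m + 1)) (Fin (m + 1)) ℤ) :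
    M.permanent * M.det ^ m
      = ∑ π : Fin (m + 1) → Equiv.Perm (Fin (m + 1)),
          (∏ k : Fin m, (Equiv.Perm.sign (π k.succ) : ℤ)) * ∏ k, ∏ i, M i (π k i) := by
  let w : Fin (m + 1) → Equiv.Perm (Fin (m + 1)) → ℤ := Fin.cons 1 fun _ σ => Equiv.Perm.sign σ
  have hprod : M.permanent * M.det ^ m = ∏ k, ∑ σ, w k σ * ∏ i, M i (σ i) := by
    rw [Fin.prod_univ_succ]
    simp only [w, Fin.cons_zero, Fin.cons_succ, Pi.one_apply, one_mul]
    rw [← M.permanent_transpose, ← M.det_transpose, Matrix.permanent, Matrix.det_apply']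
    simp
  rw [hprod, Fintype.prod_sum]
  refine Finset.sum_congr rfl fun π _ => ?_
  rw [Finset.prod_mul_distrib, Fin.prod_univ_succ]
  simp [w]

open Classical in
theorem sum_sigma0_mul_permanent_mul_det_pow (m : ℕ) :
    ∑ A : Fin (m + 1) → Fin (m + 1) → Bool,
        (-1 : ℤ) ^ sigma0 A * (toInt A).permanent * (toInt A).det ^ m
      = ∑ L : {L : Fin (m + 1) → Fin (m + 1) → Fin (m + 1) // IsLatin L},
          ∏ k : Fin m, (Equiv.Perm.sign (symPerm L.1 k.succ) : ℤ) := by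
  simp only [mul_assoc, permanent_mul_det_pow, Finset.mul_sum]
  rw [Finset.sum_comm]
  simp only [mul_left_comm ((-1 : ℤ) ^ _), ← Finset.mul_sum, sum_sigma0_mul_prod, mul_ite, mul_one,
    mul_zero]
  rw [← Finset.sum_filter, Finset.sum_subtype (p := fun π => ∀ i j, ∃ k, π k i = j) _ (by simp),
    ← (bijective_symPerm (m + 1)).sum_comp]

/-- For odd `n`,
`n! (n-1)! AT(n) = (-1)^{n(n-1)/2} ∑_{A ∈ B_n} (-1)^{σ₀(A)} per(A) det(A)^{n-1}`. -/
theorem AT_eq_signed_permanent_det_sum (n : ℕ) (hn : Odd n) :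
    (n.factorial : ℤ) * (n - 1).factorial * AT n
      = (-1) ^ (n * (n - 1) / 2) *
          ∑ A : Fin n → Fin n → Bool,
            (-1 : ℤ) ^ sigma0 A * (toInt A).permanent * (toInt A).det ^ (n - 1) := by
  classical
  obtain _ | m := n
  · simp at hn
  rw [Nat.add_sub_cancel, ← sum_latinSign_mul_sign_symPerm hn,
    sum_sigma0_mul_permanent_mul_det_pow, Finset.mul_sum]
  refine Finset.sum_congr rfl fun L _ => ?_
  have hprod := latinSign_mul_symbolSign L.2
  rw [symbolSign, Fin.prod_univ_succ, Nat.add_sub_cancel] at hprod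
  have hsq : (∏ k : Fin m, (Equiv.Perm.sign (symPerm L.1 k.succ) : ℤ)) *
      ∏ k : Fin m, (Equiv.Perm.sign (symPerm L.1 k.succ) : ℤ) = 1 := by
    rw [← Finset.prod_mul_distrib]
    exact Finset.prod_eq_one fun i _ => by rw [← Units.val_mul, Int.units_mul_self, Units.val_one]
  rw [← hprod, mul_assoc, mul_assoc, hsq, mul_one]
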